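/- arXiv:1406.5900 — 10 statements merged into one kernel-verified Lean document; each statement's English description precedes it below -/
import Mathlib

section
/- Let V be a finite-dimensional real normed vector space, f : V → V a linear map, λ a nonzero real number, and e ∈ V a nonzero vector with f(e) = λ·e. Suppose there is a subset S ⊆ V whose linear span is all of V such that for every ω ∈ S there exists a nonzero real number c with λ^{−n}·f^n(ω) → c·e as n → ∞. Then ker((f − λ·id)^k) = ℝ·e for every k ≥ 1; in particular the eigenspace of f for λ is one-dimensional and λ is an eigenvalue of f of algebraic multiplicity one (a simple eigenvalue). -/
open Filter Topology

/-- If every vector of a spanning set has rescaled iterates converging into the line of `e`,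
then so does every vector. -/
theorem exists_tendsto_rescaled_iterates_of_span_eq_top
    {V : Type*} [NormedAddCommGroup V] [NormedSpace ℝ V]
    (f : Module.End ℝ V) (lam : ℝ) (e : V) (S : Set V) (hspan : Submodule.span ℝ S = ⊤)
    (hconv : ∀ ω ∈ S, ∃ c : ℝ,
      Tendsto (fun n : ℕ => (lam ^ n)⁻¹ • (f ^ n) ω) atTop (𝓝 (c • e))) (v : V) :
    ∃ c : ℝ, Tendsto (fun n : ℕ => (lam ^ n)⁻¹ • (f ^ n) v) atTop (𝓝 (c • e)) := by
  have hv : v ∈ Submodule.span ℝ S := hspan ▸ Submodule.mem_top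
  induction hv using Submodule.span_induction with
  | mem x hx => exact hconv x hx
  | zero => exact ⟨0, by simp⟩
  | add x y _ _ hx hy =>
    obtain ⟨a, ha⟩ := hx
    obtain ⟨b, hb⟩ := hy
    exact ⟨a + b, by simpa only [map_add, smul_add, add_smul] using ha.add hb⟩
  | smul r x _ hx =>
    obtain ⟨a, ha⟩ := hx
    exact ⟨r * a, by simpa only [map_smul, smul_comm r, mul_smul] using ha.const_smul r⟩

/-- If the rescaled iterates of `v` converge into the line of the eigenvector `e` and
`f v - lam • v` lies on that line, then so does `v`. -/
theorem mem_span_singleton_of_tendsto_rescaled_iterates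
    {V : Type*} [NormedAddCommGroup V] [NormedSpace ℝ V]
    (f : Module.End ℝ V) (lam : ℝ) (hlam : lam ≠ 0) (e : V) (hfe : f e = lam • e)
    (v : V) (c : ℝ)
    (hc : Tendsto (fun n : ℕ => (lam ^ n)⁻¹ • (f ^ n) v) atTop (𝓝 (c • e)))
    (hv : f v - lam • v ∈ Submodule.span ℝ {e}) :
    v ∈ Submodule.span ℝ {e} := by
  obtain ⟨b, hb⟩ := Submodule.mem_span_singleton.mp hv
  have hfv : f v = lam • v + b • e := by rw [hb]; abel
  have hpow (n : ℕ) : (f ^ n) e = lam ^ n • e := by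
    induction n with
    | zero => simp
    | succ n ih => rw [pow_succ, Module.End.mul_apply, hfe, map_smul, ih, smul_smul, pow_succ']
  have hstep (n : ℕ) : (lam ^ (n + 1))⁻¹ • (f ^ (n + 1)) v
      = (lam ^ n)⁻¹ • (f ^ n) v + (lam⁻¹ * b) • e := by
    rw [pow_succ f, Module.End.mul_apply, hfv, map_add, map_smul, map_smul, hpow, smul_add,
      smul_smul, smul_smul, smul_smul]
    congr 2 <;> field_simp <;> ring
  have hzero : (lam⁻¹ * b) • e = 0 := by
    have hdiff := (hc.comp (tendsto_add_atTop_nat 1)).sub hc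
    simp only [Function.comp_def, hstep, add_sub_cancel_left, sub_self] at hdiff
    exact tendsto_nhds_unique tendsto_const_nhds hdiff
  have hconst (n : ℕ) : (lam ^ n)⁻¹ • (f ^ n) v = v := by
    induction n with
    | zero => simp
    | succ n ih => rw [hstep, ih, hzero, add_zero]
  simp only [hconst] at hc
  exact Submodule.mem_span_singleton.mpr ⟨c, tendsto_nhds_unique hc tendsto_const_nhds⟩

/-- If `f` is a linear endomorphism of a finite-dimensional real normed space, `λ ≠ 0`,
`e ≠ 0` is an eigenvector for `λ`, and there is a spanning set `S` such that for every
`ω ∈ S` the rescaled iterates `λ⁻ⁿ • fⁿ(ω)` converge to a nonzero multiple of `e`, then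
`ker((f - λ·id)^k) = ℝ·e` for all `k ≥ 1`; in particular `λ` is a simple eigenvalue. -/
theorem simple_eigenvalue_of_rescaled_iterates_converge
    {V : Type*} [NormedAddCommGroup V] [NormedSpace ℝ V] [FiniteDimensional ℝ V]
    (f : Module.End ℝ V) (lam : ℝ) (hlam : lam ≠ 0)
    (e : V) (he : e ≠ 0) (hfe : f e = lam • e)
    (S : Set V) (hspan : Submodule.span ℝ S = ⊤)
    (hconv : ∀ ω ∈ S, ∃ c : ℝ, c ≠ 0 ∧
      Tendsto (fun n : ℕ => (lam ^ n)⁻¹ • (f ^ n) ω) atTop (𝓝 (c • e))) :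
    ∀ k : ℕ, 1 ≤ k →
      LinearMap.ker ((f - lam • 1) ^ k) = Submodule.span ℝ {e} := by
  have hall := exists_tendsto_rescaled_iterates_of_span_eq_top f lam e S hspan
    fun ω hω => (hconv ω hω).imp fun _ h => h.2
  have hle (k : ℕ) : LinearMap.ker ((f - lam • 1) ^ k) ≤ Submodule.span ℝ {e} := by
    induction k with
    | zero => intro v hv; simp_all
    | succ k ih =>
      intro v hv
      obtain ⟨c, hc⟩ := hall v
      refine mem_span_singleton_of_tendsto_rescaled_iterates f lam hlam e hfe v c hc (ih ?_)
      rw [LinearMap.mem_ker, pow_succ, Module.End.mul_apply] at hv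
      simpa using hv
  intro k hk
  refine (hle k).antisymm ?_
  rw [Submodule.span_singleton_le_iff_mem, LinearMap.mem_ker, ← Nat.sub_add_cancel hk, pow_succ,
    Module.End.mul_apply]
  simp [hfe]
end

section
/- Let V be a nonzero finite-dimensional complex vector space, B : V × V → ℂ a nondegenerate bilinear form, and f : V → V a linear map satisfying B(f(x), f(y)) = B(x, y) for all x, y ∈ V. Let λ ∈ ℂ be nonzero, and suppose the generalized eigenspace ⋃_k ker((f − λ·id)^k) of f for λ is one-dimensional. Let u be a nonzero vector with f(u) = λ·u and let v be a nonzero vector with f(v) = λ^{−1}·v. Then B(u, v) ≠ 0. -/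
/-- If a functional `φ` satisfies `φ ∘ f = a • φ`, then `φ` vanishes on the generalized
eigenspaces of `f` for all scalars `μ ≠ a`. -/
theorem eq_zero_of_mem_maxGenEigenspace_of_apply_eq_smul
    {K V : Type*} [Field K] [AddCommGroup V] [Module K V]
    {f : Module.End K V} {φ : V →ₗ[K] K} {a μ : K} (hφ : ∀ x, φ (f x) = a * φ x)
    (hμ : μ ≠ a) {x : V} (hx : x ∈ f.maxGenEigenspace μ) : φ x = 0 := by
  obtain ⟨k, hk⟩ := (Module.End.mem_maxGenEigenspace f μ x).1 hx
  have key : ∀ (k : ℕ) (y : V), φ (((f - μ • 1) ^ k) y) = (a - μ) ^ k * φ y := by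
    intro k
    induction k with
    | zero => simp
    | succ k ih =>
      intro y
      rw [pow_succ, Module.End.mul_apply, ih]
      simp only [LinearMap.sub_apply, LinearMap.smul_apply, Module.End.one_apply, map_sub,
        map_smul, hφ, smul_eq_mul]
      ring
  have h := key k x
  rw [hk, map_zero] at h
  exact (mul_eq_zero.1 h.symm).resolve_left (pow_ne_zero k (sub_ne_zero.2 hμ.symm))

/-- If `B` is a nondegenerate bilinear form on a nonzero finite-dimensional complex vector
space, preserved by a linear map `f`, `λ ≠ 0`, the generalized eigenspace of `f` for `λ` is
one-dimensional, `u ≠ 0` is an eigenvector for `λ` and `v ≠ 0` is an eigenvector for `λ⁻¹`,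
then `B(u, v) ≠ 0`. -/
theorem bilin_eigenvectors_ne_zero
    {V : Type*} [AddCommGroup V] [Module ℂ V] [FiniteDimensional ℂ V] [Nontrivial V]
    (B : V →ₗ[ℂ] V →ₗ[ℂ] ℂ)
    (hBleft : ∀ x : V, (∀ y : V, B x y = 0) → x = 0)
    (hBright : ∀ y : V, (∀ x : V, B x y = 0) → y = 0)
    (f : Module.End ℂ V) (hBf : ∀ x y : V, B (f x) (f y) = B x y)
    (lam : ℂ) (hlam : lam ≠ 0)
    (hgen : Module.finrank ℂ ↥(⨆ k : ℕ, LinearMap.ker ((f - lam • 1) ^ k)) = 1)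
    (u : V) (hu : u ≠ 0) (hfu : f u = lam • u)
    (v : V) (hv : v ≠ 0) (hfv : f v = lam⁻¹ • v) :
    B u v ≠ 0 := by
  intro huv
  have hφ : ∀ x, B.flip v (f x) = lam * B.flip v x := by
    intro x
    have h := hBf x v
    rw [hfv, map_smul, smul_eq_mul] at h
    rw [LinearMap.flip_apply, LinearMap.flip_apply, ← h, mul_inv_cancel_left₀ hlam]
  have hu_mem : u ∈ ⨆ k : ℕ, LinearMap.ker ((f - lam • 1) ^ k) :=
    Submodule.mem_iSup_of_mem 1 (by simp [hfu])
  have hlam_zero : ∀ x ∈ f.maxGenEigenspace lam, B x v = 0 := by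
    intro x hx
    obtain ⟨k, hk⟩ := (Module.End.mem_maxGenEigenspace f lam x).1 hx
    have hx_mem : x ∈ ⨆ k : ℕ, LinearMap.ker ((f - lam • 1) ^ k) :=
      Submodule.mem_iSup_of_mem k hk
    obtain ⟨c, hc⟩ := (finrank_eq_one_iff_of_nonzero' ⟨u, hu_mem⟩
      (by simpa using hu)).1 hgen ⟨x, hx_mem⟩
    have hc' : c • u = x := congrArg Subtype.val hc
    rw [← hc', map_smul, LinearMap.smul_apply, huv, smul_zero]
  refine hv (hBright v fun x => ?_)
  have hle : ⨆ μ : ℂ, f.maxGenEigenspace μ ≤ LinearMap.ker (B.flip v) := by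
    refine iSup_le fun μ x hx => ?_
    rw [LinearMap.mem_ker]
    by_cases hμ : μ = lam
    · subst hμ
      exact hlam_zero x hx
    · exact eq_zero_of_mem_maxGenEigenspace_of_apply_eq_smul hφ hμ hx
  rw [Module.End.iSup_maxGenEigenspace_eq_top] at hle
  exact hle Submodule.mem_top
end

section
/- Let V be a finite-dimensional real vector space, Φ : V → V a linear map, λ a nonzero real number, and a ∈ V a nonzero vector with Φ(a) = λ·a such that ker((Φ − λ·id)^k) = ℝ·a for every k ≥ 1 (λ is an eigenvalue of algebraic multiplicity one). Let K : V → V be an arbitrary linear map. Define the linear map T : V × ℝ × V → V × V by T(x, y₀, y) = ((Φ − λ·id)(x) − 2λ·y₀·a + K(y), (Φ − id)(y)). Then dim ker T = 1 + dim ker(Φ − id). -/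
/-- If the kernels of `f` and `f ^ 2` agree, the range and the kernel of `f` intersect trivially. -/
theorem disjoint_range_ker_of_ker_sq_le {R M : Type*} [Ring R] [AddCommGroup M] [Module R M]
    {f : Module.End R M} (h : LinearMap.ker (f ^ 2) ≤ LinearMap.ker f) :
    Disjoint (LinearMap.range f) (LinearMap.ker f) := by
  rw [Submodule.disjoint_def]
  rintro _ ⟨x, rfl⟩ hx
  refine h (?_ : x ∈ LinearMap.ker (f ^ 2))
  simpa [pow_two] using hx

/-- Kernel dimension count for the block linear map
`T(x, y₀, y) = ((Φ - λ·id)(x) - 2λ·y₀·a + K(y), (Φ - id)(y))`, where `λ` is an eigenvalue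
of `Φ` of algebraic multiplicity one with eigenvector `a`:
`dim ker T = 1 + dim ker (Φ - id)`. -/
theorem finrank_ker_block_map
    {V : Type*} [AddCommGroup V] [Module ℝ V] [FiniteDimensional ℝ V]
    (Φ : Module.End ℝ V) (lam : ℝ) (hlam : lam ≠ 0)
    (a : V) (ha : a ≠ 0) (hΦa : Φ a = lam • a)
    (hsimple : ∀ k : ℕ, 1 ≤ k →
      LinearMap.ker ((Φ - lam • 1) ^ k) = Submodule.span ℝ {a})
    (K : Module.End ℝ V)
    (T : (V × ℝ × V) →ₗ[ℝ] (V × V))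
    (hT : ∀ (x : V) (y₀ : ℝ) (y : V),
      T (x, y₀, y) = ((Φ - lam • 1) x - (2 * lam * y₀) • a + K y, (Φ - 1) y)) :
    Module.finrank ℝ (LinearMap.ker T) =
      1 + Module.finrank ℝ (LinearMap.ker (Φ - 1)) := by
  set N : Module.End ℝ V := Φ - lam • 1 with hN
  have hker : LinearMap.ker N = Submodule.span ℝ {a} := by simpa using hsimple 1 le_rfl
  have hdisj : Disjoint (LinearMap.range N) (LinearMap.ker N) :=
    disjoint_range_ker_of_ker_sq_le (by rw [hker, hsimple 2 one_le_two])
  have htop : LinearMap.range N ⊔ LinearMap.ker N = ⊤ :=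
    Submodule.eq_top_of_disjoint _ _ (LinearMap.finrank_range_add_finrank_ker N).ge hdisj
  have haN : N a = 0 := by simp [hN, hΦa]
  have hmem : ∀ (x : V) (y₀ : ℝ) (y : V), (x, y₀, y) ∈ LinearMap.ker T ↔
      N x - (2 * lam * y₀) • a + K y = 0 ∧ (Φ - 1) y = 0 := by
    intro x y₀ y
    rw [LinearMap.mem_ker, hT, Prod.mk_eq_zero]
  have haT : ((a, 0, 0) : V × ℝ × V) ∈ LinearMap.ker T := (hmem _ _ _).2 (by simp [haN])
  let p : LinearMap.ker T →ₗ[ℝ] V :=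
    (LinearMap.snd ℝ ℝ V ∘ₗ LinearMap.snd ℝ V (ℝ × V)) ∘ₗ (LinearMap.ker T).subtype
  have hrange : LinearMap.range p = LinearMap.ker (Φ - 1) := by
    apply le_antisymm
    · rintro _ ⟨⟨⟨x, y₀, y⟩, h⟩, rfl⟩
      exact ((hmem x y₀ y).1 h).2
    · intro y hy
      have hKy : -K y ∈ LinearMap.range N ⊔ LinearMap.ker N := htop ▸ Submodule.mem_top
      obtain ⟨_, ⟨x, rfl⟩, w, hw, hsum⟩ := Submodule.mem_sup.1 hKy
      rw [hker] at hw
      obtain ⟨c, rfl⟩ := Submodule.mem_span_singleton.1 hw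
      have hc : 2 * lam * (-c / (2 * lam)) = -c := by field_simp
      refine ⟨⟨(x, -c / (2 * lam), y), (hmem _ _ _).2 ⟨?_, hy⟩⟩, rfl⟩
      rw [hc, neg_smul, sub_neg_eq_add, hsum, neg_add_cancel]
  have hkerp : LinearMap.ker p = Submodule.span ℝ {⟨(a, 0, 0), haT⟩} := by
    apply le_antisymm
    · rintro ⟨⟨x, y₀, y⟩, h⟩ hy
      obtain rfl : y = 0 := hy
      have hx : N x = (2 * lam * y₀) • a := by
        simpa [sub_eq_zero] using ((hmem _ _ _).1 h).1
      have hzero : N x = 0 := Submodule.disjoint_def.1 hdisj _ ⟨x, rfl⟩ (by simp [hx, haN])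
      obtain rfl : y₀ = 0 := by simpa [hzero, hlam, ha] using hx.symm
      have hxa : x ∈ Submodule.span ℝ {a} := hker ▸ hzero
      obtain ⟨c, rfl⟩ := Submodule.mem_span_singleton.1 hxa
      exact Submodule.mem_span_singleton.2 ⟨c, Subtype.ext (by simp)⟩
    · rw [Submodule.span_singleton_le_iff_mem]
      rfl
  have hone : Module.finrank ℝ (LinearMap.ker p) = 1 := by
    rw [hkerp]
    exact finrank_span_singleton (by simpa [Subtype.ext_iff] using ha)
  rw [← LinearMap.finrank_range_add_finrank_ker p, hrange, hone, add_comm]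
end

section
/- For all real numbers a, b, c, x, y, z, the matrix S(a,b,c) applied to the vector emb(x,y,z) equals emb(a + e^{−c}·x, b + e^{c}·y, z + c). In particular each S(a,b,c) maps the set {emb(x,y,z) : (x,y,z) ∈ ℝ³} onto itself. -/
/-- The Sol isometry matrix `S(a,b,c)`. -/
noncomputable def SolS (a b c : ℝ) : Matrix (Fin 4) (Fin 4) ℝ :=
  !![Real.cosh c, Real.sinh c, 0, 0;
     Real.sinh c, Real.cosh c, 0, 0;
     a * Real.exp c, a * Real.exp c, 1, 0;
     b * Real.exp (-c), -(b * Real.exp (-c)), 0, 1]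

/-- The embedding of Sol into `ℝ⁴` (projective space). -/
noncomputable def solEmb (x y z : ℝ) : Fin 4 → ℝ :=
  ![Real.cosh z, Real.sinh z, Real.exp z * x, Real.exp (-z) * y]

theorem SolS_mulVec (a b c x y z : ℝ) :
    (SolS a b c).mulVec (solEmb x y z) =
      solEmb (a + Real.exp (-c) * x) (b + Real.exp c * y) (z + c) := by
  have hc : Real.exp c * Real.exp (-c) = 1 := by rw [← Real.exp_add]; simp
  have hadd := Real.cosh_add_sinh z
  have hsub := Real.cosh_sub_sinh z
  ext i
  fin_cases i <;>
    simp [SolS, solEmb, Matrix.mulVec, dotProduct, Fin.sum_univ_four, Real.cosh_add,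
      Real.sinh_add, Real.exp_add]
  · ring
  · ring
  · linear_combination a * Real.exp c * hadd - Real.exp z * x * hc
  · linear_combination b * Real.exp (-c) * hsub - Real.exp (-z) * y * hc

/-- `S(a,b,c)` applied to `emb(x,y,z)` equals `emb(a + e^{-c}x, b + e^{c}y, z + c)`;
in particular each `S(a,b,c)` maps the image of the embedding onto itself. -/
theorem solS_mulVec_solEmb (a b c : ℝ) :
    (∀ x y z : ℝ,
      (SolS a b c).mulVec (solEmb x y z) =
        solEmb (a + Real.exp (-c) * x) (b + Real.exp c * y) (z + c)) ∧
    (fun v : Fin 4 → ℝ => (SolS a b c).mulVec v) ''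
        {v | ∃ x y z : ℝ, v = solEmb x y z} =
      {v | ∃ x y z : ℝ, v = solEmb x y z} := by
  refine ⟨SolS_mulVec a b c, Set.Subset.antisymm ?_ ?_⟩
  · rintro _ ⟨_, ⟨x, y, z, rfl⟩, rfl⟩
    exact ⟨_, _, _, SolS_mulVec a b c x y z⟩
  · rintro _ ⟨x, y, z, rfl⟩
    refine ⟨_, ⟨Real.exp c * (x - a), Real.exp (-c) * (y - b), z - c, rfl⟩, ?_⟩
    simp only [SolS_mulVec, ← mul_assoc, ← Real.exp_add]
    simp
end

section
/- Let A : ℝ → M₄(ℝ) be a matrix-valued function that is continuous at 0, whose entries t ↦ A(t)₄₁, A(t)₄₂, A(t)₄₃ are differentiable at t = 0, and such that A(0) has block form [[B, 0],[0, 1]], i.e., A(0)ᵢ₄ = 0 and A(0)₄ᵢ = 0 for i = 1, 2, 3 and A(0)₄₄ = 1, where B denotes the upper-left 3×3 block of A(0). Then, as t → 0 through nonzero values, the conjugated matrices r(t)·A(t)·r(t)^{−1} converge to the matrix [[B, 0],[vᵀ, 1]], where vⱼ is the derivative of t ↦ A(t)₄ⱼ at t = 0 for j = 1, 2, 3. 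-/
open Filter Topology

/-- The rescaling matrix `r(t) = diag(1,1,1,t⁻¹)` used in the transition from hyperbolic
to half-pipe geometry. -/
noncomputable def hpRescale (t : ℝ) : Matrix (Fin 4) (Fin 4) ℝ :=
  Matrix.diagonal ![1, 1, 1, t⁻¹]

theorem hpRescale_inv {t : ℝ} (ht : t ≠ 0) :
    (hpRescale t)⁻¹ = Matrix.diagonal ![1, 1, 1, t] := by
  refine Matrix.inv_eq_right_inv ?_
  rw [hpRescale, Matrix.diagonal_mul_diagonal, ← Matrix.diagonal_one]
  congr 1
  ext i
  fin_cases i <;> simp [ht]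

theorem hpRescale_conj_apply {t : ℝ} (ht : t ≠ 0) (M : Matrix (Fin 4) (Fin 4) ℝ)
    (i j : Fin 4) :
    (hpRescale t * M * (hpRescale t)⁻¹) i j =
      (if i = 3 then t⁻¹ else 1) * M i j * (if j = 3 then t else 1) := by
  rw [hpRescale_inv ht, Matrix.mul_diagonal, hpRescale, Matrix.diagonal_mul]
  congr 2
  · fin_cases i <;> simp
  · fin_cases j <;> simp

/-- If `A : ℝ → M₄(ℝ)` is continuous at `0`, the bottom-row entries `A(t)₄ⱼ` (`j ≠ 4`) are
differentiable at `0` with derivatives `vⱼ`, and `A(0)` has block form `[[B, 0], [0, 1]]`,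
then `r(t)·A(t)·r(t)⁻¹ → [[B, 0], [vᵀ, 1]]` as `t → 0` through nonzero values. -/
theorem rescaled_conj_tendsto_HP_matrix
    (A : ℝ → Matrix (Fin 4) (Fin 4) ℝ) (hA : ContinuousAt A 0)
    (v : Fin 4 → ℝ)
    (hderiv : ∀ j : Fin 4, j ≠ 3 → HasDerivAt (fun t : ℝ => A t 3 j) (v j) 0)
    (hcol : ∀ i : Fin 4, i ≠ 3 → A 0 i 3 = 0)
    (hrow : ∀ j : Fin 4, j ≠ 3 → A 0 3 j = 0)
    (hcorner : A 0 3 3 = 1) :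
    Tendsto (fun t : ℝ => hpRescale t * A t * (hpRescale t)⁻¹) (𝓝[≠] 0)
      (𝓝 (Matrix.of fun i j : Fin 4 =>
        if i = 3 then (if j = 3 then 1 else v j)
        else (if j = 3 then 0 else A 0 i j))) := by
  have hentry (i j : Fin 4) : Tendsto (fun t => A t i j) (𝓝[≠] 0) (𝓝 (A 0 i j)) :=
    ((continuous_id.matrix_elem i j).continuousAt.comp hA).tendsto.mono_left nhdsWithin_le_nhds
  have hid : Tendsto (fun t : ℝ => t) (𝓝[≠] 0) (𝓝 0) :=
    tendsto_id.mono_left nhdsWithin_le_nhds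
  refine tendsto_pi_nhds.2 fun i => tendsto_pi_nhds.2 fun j => ?_
  refine Tendsto.congr' (eventually_mem_nhdsWithin.mono fun t ht =>
    (hpRescale_conj_apply ht (A t) i j).symm) ?_
  by_cases hi : i = 3 <;> by_cases hj : j = 3
  · subst hi hj
    refine Tendsto.congr' (f₁ := fun t => A t 3 3)
      (eventually_mem_nhdsWithin.mono fun t (ht : t ≠ 0) => ?_) ?_
    · simp only [if_true]
      field_simp
    · simpa [hcorner] using hentry 3 3
  · subst hi
    simpa [hj, hrow j hj] using (hderiv j hj).tendsto_slope_zero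
  · subst hj
    simpa [hi, hcol i hi] using (hentry i 3).mul hid
  · simpa [hi, hj] using hentry i j
end

section
/- For real numbers λ > 0 and y₀, let T(λ, y₀) be the 4×4 real matrix whose rows are ((λ+λ^{−1})/2, (λ−λ^{−1})/2, 0, 0), ((λ−λ^{−1})/2, (λ+λ^{−1})/2, 0, 0), (0, 0, 1, 0), and (0, 0, 2y₀, 1). Then, as s → 0 through positive values, the conjugated matrices r₁(s)·T(λ, y₀)·r₁(s)^{−1} converge to the 4×4 real matrix whose rows are ((λ+λ^{−1})/2, (λ−λ^{−1})/2, 0, 0), ((λ−λ^{−1})/2, (λ+λ^{−1})/2, 0, 0), (0, 0, 1, 0), and (0, 0, 0, 1). -/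
open Filter Topology

/-- The half-pipe holonomy matrix `T(λ, y₀)` of the suspension direction. -/
noncomputable def THP (lam y₀ : ℝ) : Matrix (Fin 4) (Fin 4) ℝ :=
  !![(lam + lam⁻¹) / 2, (lam - lam⁻¹) / 2, 0, 0;
     (lam - lam⁻¹) / 2, (lam + lam⁻¹) / 2, 0, 0;
     0, 0, 1, 0;
     0, 0, 2 * y₀, 1]

/-- The rescaling matrix `r₁(s)` deforming half-pipe geometry to Sol geometry. -/
noncomputable def r1 (s : ℝ) : Matrix (Fin 4) (Fin 4) ℝ :=
  !![(s + s⁻¹) / 2, (s - s⁻¹) / 2, 0, 0;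
     (s - s⁻¹) / 2, (s + s⁻¹) / 2, 0, 0;
     0, 0, 0, -s;
     0, 0, s⁻¹, 0]

/-- For `s ≠ 0`, conjugating `T(λ, y₀)` by `r₁(s)` fixes the hyperbolic block and turns the lower
entry `2y₀` into the upper entry `-2y₀s²`. -/
theorem r1_mul_THP_mul_inv (lam y₀ : ℝ) {s : ℝ} (hs : s ≠ 0) :
    r1 s * THP lam y₀ * (r1 s)⁻¹ =
      !![(lam + lam⁻¹) / 2, (lam - lam⁻¹) / 2, 0, 0;
         (lam - lam⁻¹) / 2, (lam + lam⁻¹) / 2, 0, 0;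
         0, 0, 1, -(2 * y₀ * s ^ 2);
         0, 0, 0, 1] := by
  have hinv : (r1 s)⁻¹ =
      !![(s + s⁻¹) / 2, -((s - s⁻¹) / 2), 0, 0;
         -((s - s⁻¹) / 2), (s + s⁻¹) / 2, 0, 0;
         0, 0, 0, s;
         0, 0, -s⁻¹, 0] := by
    apply Matrix.inv_eq_right_inv
    ext i j
    fin_cases i <;> fin_cases j <;>
      simp [r1, Matrix.mul_apply, Fin.sum_univ_four, hs] <;> field_simp <;> ring
  rw [hinv, THP]
  generalize lam⁻¹ = mu
  ext i j
  fin_cases i <;> fin_cases j <;>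
    simp [r1, Matrix.mul_apply, Fin.sum_univ_four, hs] <;> field_simp <;> ring

/-- As `s → 0⁺`, the conjugates `r₁(s)·T(λ,y₀)·r₁(s)⁻¹` converge to the Sol holonomy
matrix `ρ_Sol(τ)`. -/
theorem r1_conj_THP_tendsto_sol (lam y₀ : ℝ) (hlam : 0 < lam) :
    Tendsto (fun s : ℝ => r1 s * THP lam y₀ * (r1 s)⁻¹) (𝓝[>] 0)
      (𝓝 !![(lam + lam⁻¹) / 2, (lam - lam⁻¹) / 2, 0, 0;
            (lam - lam⁻¹) / 2, (lam + lam⁻¹) / 2, 0, 0;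
            0, 0, 1, 0;
            0, 0, 0, 1]) := by
  have key : Tendsto (fun s : ℝ =>
      !![(lam + lam⁻¹) / 2, (lam - lam⁻¹) / 2, 0, 0;
         (lam - lam⁻¹) / 2, (lam + lam⁻¹) / 2, 0, 0;
         0, 0, 1, -(2 * y₀ * s ^ 2);
         0, 0, 0, 1]) (𝓝 0)
      (𝓝 !![(lam + lam⁻¹) / 2, (lam - lam⁻¹) / 2, 0, 0;
            (lam - lam⁻¹) / 2, (lam + lam⁻¹) / 2, 0, 0;
            0, 0, 1, 0;
            0, 0, 0, 1]) := by
    refine Continuous.tendsto' ?_ _ _ (by simp)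
    refine continuous_matrix fun i j => ?_
    fin_cases i <;> fin_cases j <;> simp <;> fun_prop
  refine (key.mono_left nhdsWithin_le_nhds).congr' ?_
  filter_upwards [self_mem_nhdsWithin] with s hs
  exact (r1_mul_THP_mul_inv lam y₀ (ne_of_gt hs)).symm
end

section
/- Fix real numbers ω, μ, d and a sign ε ∈ {1, −1}. For t ∈ ℝ let R_m(t) be the 4×4 real matrix with upper-left 2×2 block the identity, lower-right 2×2 block [[cos(ωt), −sin(ωt)],[sin(ωt), cos(ωt)]], and zero off-diagonal blocks, and let R_l(t) be the 4×4 real matrix with upper-left 2×2 block [[cosh d, sinh d],[sinh d, cosh d]], lower-right 2×2 block [[ε·cos(μt), −sin(μt)],[sin(μt), ε·cos(μt)]], and zero off-diagonal blocks. Then, as t → 0 through nonzero values, r(t)·R_m(t)·r(t)^{−1} converges to the matrix with rows (1,0,0,0), (0,1,0,0), (0,0,1,0), (0,0,ω,1), and r(t)·R_l(t)·r(t)^{−1} converges to the matrix with rows (cosh d, sinh d, 0, 0), (sinh d, cosh d, 0, 0), (0, 0, ε, 0), (0, 0, μ, ε). -/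
open Filter Topology

/-- The meridian holonomy `R_m(t)` of the model family of cone singularities. -/
noncomputable def Rmer (ω t : ℝ) : Matrix (Fin 4) (Fin 4) ℝ :=
  !![1, 0, 0, 0;
     0, 1, 0, 0;
     0, 0, Real.cos (ω * t), -Real.sin (ω * t);
     0, 0, Real.sin (ω * t), Real.cos (ω * t)]

/-- The longitude holonomy `R_l(t)` of the model family of cone singularities. -/
noncomputable def Rlong (d μ ε t : ℝ) : Matrix (Fin 4) (Fin 4) ℝ :=
  !![Real.cosh d, Real.sinh d, 0, 0;
     Real.sinh d, Real.cosh d, 0, 0;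
     0, 0, ε * Real.cos (μ * t), -Real.sin (μ * t);
     0, 0, Real.sin (μ * t), ε * Real.cos (μ * t)]

theorem Rmer_eq_Rlong (ω t : ℝ) : Rmer ω t = Rlong 0 ω 1 t := by
  simp [Rmer, Rlong]

theorem hpRescale_conj_Rlong (d μ ε : ℝ) {t : ℝ} (ht : t ≠ 0) :
    hpRescale t * Rlong d μ ε t * (hpRescale t)⁻¹ =
      !![Real.cosh d, Real.sinh d, 0, 0;
         Real.sinh d, Real.cosh d, 0, 0;
         0, 0, ε * Real.cos (μ * t), -Real.sin (μ * t) * t;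
         0, 0, t⁻¹ * Real.sin (μ * t), ε * Real.cos (μ * t)] := by
  rw [hpRescale_inv ht]
  ext i j
  rw [hpRescale, Matrix.mul_diagonal, Matrix.diagonal_mul]
  fin_cases i <;> fin_cases j <;> simp [Rlong]
  field_simp

theorem tendsto_inv_mul_sin_mul (μ : ℝ) :
    Tendsto (fun t : ℝ => t⁻¹ * Real.sin (μ * t)) (𝓝[≠] 0) (𝓝 μ) := by
  have h : HasDerivAt (fun t : ℝ => Real.sin (μ * t)) μ 0 := by
    simpa using ((hasDerivAt_id (0 : ℝ)).const_mul μ).sin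
  simpa using h.tendsto_slope_zero

theorem tendsto_hpRescale_conj_Rlong (d μ ε : ℝ) :
    Tendsto (fun t : ℝ => hpRescale t * Rlong d μ ε t * (hpRescale t)⁻¹) (𝓝[≠] 0)
      (𝓝 !![Real.cosh d, Real.sinh d, 0, 0;
            Real.sinh d, Real.cosh d, 0, 0;
            0, 0, ε, 0;
            0, 0, μ, ε]) := by
  have hcos : Tendsto (fun t : ℝ => ε * Real.cos (μ * t)) (𝓝[≠] 0) (𝓝 ε) := by
    refine tendsto_nhdsWithin_of_tendsto_nhds ?_
    exact Continuous.tendsto' (by fun_prop) _ _ (by simp)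
  have hsin : Tendsto (fun t : ℝ => -Real.sin (μ * t) * t) (𝓝[≠] 0) (𝓝 0) := by
    refine tendsto_nhdsWithin_of_tendsto_nhds ?_
    exact Continuous.tendsto' (by fun_prop) _ _ (by simp)
  refine Tendsto.congr' (eventually_mem_nhdsWithin.mono fun t ht =>
    (hpRescale_conj_Rlong d μ ε ht).symm) ?_
  refine tendsto_pi_nhds.2 fun i => tendsto_pi_nhds.2 fun j => ?_
  fin_cases i <;> fin_cases j <;>
    first
    | exact tendsto_const_nhds
    | exact hcos
    | exact hsin
    | exact tendsto_inv_mul_sin_mul μ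

/-- As `t → 0` through nonzero values, the rescaled conjugates of the model meridian and
longitude holonomies converge to the model half-pipe holonomies `ρ_HP(m)` and `ρ_HP(l)`. -/
theorem rescaled_cone_model_tendsto_HP (ω μ d ε : ℝ) (hε : ε = 1 ∨ ε = -1) :
    Tendsto (fun t : ℝ => hpRescale t * Rmer ω t * (hpRescale t)⁻¹) (𝓝[≠] 0)
      (𝓝 !![(1 : ℝ), 0, 0, 0;
            0, 1, 0, 0;
            0, 0, 1, 0;
            0, 0, ω, 1]) ∧
    Tendsto (fun t : ℝ => hpRescale t * Rlong d μ ε t * (hpRescale t)⁻¹) (𝓝[≠] 0)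
      (𝓝 !![Real.cosh d, Real.sinh d, 0, 0;
            Real.sinh d, Real.cosh d, 0, 0;
            0, 0, ε, 0;
            0, 0, μ, ε]) := by
  refine ⟨?_, tendsto_hpRescale_conj_Rlong d μ ε⟩
  simpa only [Rmer_eq_Rlong, Real.cosh_zero, Real.sinh_zero] using
    tendsto_hpRescale_conj_Rlong 0 ω 1
end

section
/- For all real numbers a, b, x, y, a′, b′, x′, y′, the matrix M_HP(a,b,x,y) is invertible, and the commutator M_HP(a,b,x,y)·M_HP(a′,b′,x′,y′)·M_HP(a,b,x,y)^{−1}·M_HP(a′,b′,x′,y′)^{−1} agrees with the 4×4 identity matrix in its first three rows; moreover its (4,4) entry equals 1, its (4,1) and (4,2) entries are negatives of each other, and its (4,3) entry equals 2(a·b′ − a′·b). -/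
/-- The half-pipe holonomy matrix `M_HP(a,b,x,y)`. -/
noncomputable def MHP (a b x y : ℝ) : Matrix (Fin 4) (Fin 4) ℝ :=
  !![1 + a ^ 2 / 2, -(a ^ 2 / 2), a, 0;
     a ^ 2 / 2, 1 - a ^ 2 / 2, a, 0;
     a, -a, 1, 0;
     -b - a ^ 2 * b + 2 * a * y + x, -b + a ^ 2 * b - 2 * a * y - x, 2 * y - 2 * a * b, 1]

/-- The matrices `MHP a b x y` are closed under multiplication. -/
theorem MHP_mul (a b x y a' b' x' y' : ℝ) :
    MHP a b x y * MHP a' b' x' y' =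
      MHP (a + a') (b + b') (x + x' - 2 * a * y' - a ^ 2 * b') (y + y' + a * b') := by
  ext i j
  fin_cases i <;> fin_cases j <;>
    simp [MHP, Matrix.mul_apply, Fin.sum_univ_four] <;> ring

theorem MHP_zero : MHP 0 0 0 0 = 1 := by
  ext i j
  fin_cases i <;> fin_cases j <;> simp [MHP]

theorem MHP_mul_eq_one (a b x y : ℝ) :
    MHP a b x y * MHP (-a) (-b) (-x + a ^ 2 * b - 2 * a * y) (-y + a * b) = 1 := by
  rw [MHP_mul, ← MHP_zero]
  congr 1 <;> ring

theorem MHP_inv (a b x y : ℝ) :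
    (MHP a b x y)⁻¹ = MHP (-a) (-b) (-x + a ^ 2 * b - 2 * a * y) (-y + a * b) :=
  Matrix.inv_eq_right_inv (MHP_mul_eq_one a b x y)

/-- `M_HP(a,b,x,y)` is invertible, and the commutator of two such matrices agrees with the
identity in its first three rows, has `(4,4)` entry `1`, `(4,1)` and `(4,2)` entries
negatives of each other, and `(4,3)` entry `2(a·b' − a'·b)`. -/
theorem MHP_commutator (a b x y a' b' x' y' : ℝ) :
    IsUnit (MHP a b x y) ∧
    (let C : Matrix (Fin 4) (Fin 4) ℝ :=
      MHP a b x y * MHP a' b' x' y' * (MHP a b x y)⁻¹ * (MHP a' b' x' y')⁻¹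
     (∀ i : Fin 4, i ≠ 3 → ∀ j : Fin 4, C i j = (1 : Matrix (Fin 4) (Fin 4) ℝ) i j) ∧
      C 3 3 = 1 ∧ C 3 0 = -C 3 1 ∧ C 3 2 = 2 * (a * b' - a' * b)) := by
  refine ⟨IsUnit.of_mul_eq_one _ (MHP_mul_eq_one a b x y), ?_⟩
  intro C
  obtain ⟨t, hC⟩ : ∃ t, C = MHP 0 0 t (a * b' - a' * b) := by
    simp only [C, MHP_inv, MHP_mul]
    exact ⟨_, congr (congr (congrArg₂ MHP (by ring) (by ring)) rfl) (by ring)⟩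
  rw [hC]
  refine ⟨fun i hi j => ?_, ?_, ?_, ?_⟩
  · fin_cases i <;> fin_cases j <;> simp [MHP] at hi ⊢
  all_goals simp [MHP]
end

section
/- Let g ≥ 1 and let aᵢ, bᵢ, xᵢ, yᵢ, a′ᵢ, b′ᵢ, x′ᵢ, y′ᵢ (for i = 1, …, g) be real numbers. Then the product of commutators ∏_{i=1}^{g} M_HP(aᵢ,bᵢ,xᵢ,yᵢ)·M_HP(a′ᵢ,b′ᵢ,x′ᵢ,y′ᵢ)·M_HP(aᵢ,bᵢ,xᵢ,yᵢ)^{−1}·M_HP(a′ᵢ,b′ᵢ,x′ᵢ,y′ᵢ)^{−1} agrees with the 4×4 identity matrix in its first three rows, has (4,4) entry 1, and its (4,3) entry equals 2·∑_{i=1}^{g}(aᵢ·b′ᵢ − a′ᵢ·bᵢ), i.e., twice the standard symplectic pairing of the vectors (a₁,…,a_g,a′₁,…,a′_g) and (b₁,…,b_g,b′₁,…,b′_g) in ℝ^{2g}. -/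
namespace MHP

theorem mul_eq (a b x y a' b' x' y' : ℝ) :
    MHP a b x y * MHP a' b' x' y' =
      MHP (a + a') (b + b') (x + x' - a ^ 2 * b' - 2 * a * y') (y + y' + a * b') := by
  ext i j
  fin_cases i <;> fin_cases j <;> simp [MHP, Matrix.mul_apply, Fin.sum_univ_four] <;> ring

theorem zero_eq_one : MHP 0 0 0 0 = 1 := by
  ext i j
  fin_cases i <;> fin_cases j <;> simp [MHP]

theorem inv_eq (a b x y : ℝ) :
    (MHP a b x y)⁻¹ = MHP (-a) (-b) (-x + a ^ 2 * b - 2 * a * y) (-y + a * b) := by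
  apply Matrix.inv_eq_right_inv
  rw [mul_eq, ← zero_eq_one]
  congr 1 <;> ring

theorem exists_commutator (a b x y a' b' x' y' : ℝ) :
    ∃ X, MHP a b x y * MHP a' b' x' y' * (MHP a b x y)⁻¹ * (MHP a' b' x' y')⁻¹ =
      MHP 0 0 X (a * b' - a' * b) := by
  simp only [inv_eq, mul_eq]
  refine Exists.intro ?X ?eq
  case eq =>
    congr 1
    · ring
    · ring
    · rfl
    · ring

theorem exists_prod_commutator {g : ℕ} (a b x y a' b' x' y' : Fin g → ℝ) :
    ∃ X, (List.ofFn fun i =>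
        MHP (a i) (b i) (x i) (y i) * MHP (a' i) (b' i) (x' i) (y' i) *
          (MHP (a i) (b i) (x i) (y i))⁻¹ * (MHP (a' i) (b' i) (x' i) (y' i))⁻¹).prod =
      MHP 0 0 X (∑ i, (a i * b' i - a' i * b i)) := by
  choose X hX using fun i =>
    exists_commutator (a i) (b i) (x i) (y i) (a' i) (b' i) (x' i) (y' i)
  simp only [hX]
  clear hX
  refine ⟨∑ i, X i, ?_⟩
  induction g with
  | zero => simp [zero_eq_one]
  | succ n ih =>
    rw [List.ofFn_succ, List.prod_cons, ih (fun i => a i.succ) (fun i => b i.succ)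
      (fun i => x i.succ) (fun i => y i.succ) (fun i => a' i.succ) (fun i => b' i.succ)
      (fun i => x' i.succ) (fun i => y' i.succ) (fun i => X i.succ), mul_eq,
      Fin.sum_univ_succ, Fin.sum_univ_succ]
    congr 1 <;> ring

end MHP

/-- The (ordered) product of commutators
`∏ᵢ M_HP(aᵢ,bᵢ,xᵢ,yᵢ)·M_HP(a'ᵢ,b'ᵢ,x'ᵢ,y'ᵢ)·M_HP(aᵢ,bᵢ,xᵢ,yᵢ)⁻¹·M_HP(a'ᵢ,b'ᵢ,x'ᵢ,y'ᵢ)⁻¹`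
agrees with the identity in its first three rows, has `(4,4)` entry `1`, and has `(4,3)`
entry `2·∑ᵢ (aᵢ·b'ᵢ − a'ᵢ·bᵢ)`, twice the standard symplectic pairing of the vectors
`(a, a')` and `(b, b')` in `ℝ^{2g}`. -/
theorem MHP_commutator_product (g : ℕ) (hg : 1 ≤ g)
    (a b x y a' b' x' y' : Fin g → ℝ) :
    let C : Fin g → Matrix (Fin 4) (Fin 4) ℝ := fun i =>
      MHP (a i) (b i) (x i) (y i) * MHP (a' i) (b' i) (x' i) (y' i) *
        (MHP (a i) (b i) (x i) (y i))⁻¹ * (MHP (a' i) (b' i) (x' i) (y' i))⁻¹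
    let Pr : Matrix (Fin 4) (Fin 4) ℝ := (List.ofFn C).prod
    (∀ i : Fin 4, i ≠ 3 → ∀ j : Fin 4, Pr i j = (1 : Matrix (Fin 4) (Fin 4) ℝ) i j) ∧
      Pr 3 3 = 1 ∧
      Pr 3 2 = 2 * ∑ i : Fin g, (a i * b' i - a' i * b i) := by
  intro C Pr
  obtain ⟨X, hX⟩ := MHP.exists_prod_commutator a b x y a' b' x' y'
  have hPr : Pr = MHP 0 0 X (∑ i, (a i * b' i - a' i * b i)) := hX
  rw [hPr]
  refine ⟨fun i hi j => ?_, ?_, ?_⟩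
  · fin_cases i <;> fin_cases j <;> simp [MHP] at hi ⊢
  · simp [MHP]
  · simp [MHP]
end

section
/- The characteristic polynomial of the 4×4 integer matrix M with rows (3, −1, −2, 1), (−1, 3, 1, −2), (−1, 0, 1, 0), (0, −1, 0, 1) equals (X² − 5X + 1)·(X² − 3X + 1) = X⁴ − 8X³ + 17X² − 8X + 1. Consequently, over ℝ, the eigenvalues of M are (5+√21)/2, (5−√21)/2, (3+√5)/2, and (3−√5)/2, each of algebraic multiplicity one, and 1 is not an eigenvalue of M. -/
open Polynomial

/-- The matrix of the induced cohomology action `φ*` in the genus-two example. -/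
def Mex : Matrix (Fin 4) (Fin 4) ℤ :=
  !![3, -1, -2, 1;
     -1, 3, 1, -2;
     -1, 0, 1, 0;
     0, -1, 0, 1]

theorem Mex_charpoly_eq_mul :
    Mex.charpoly = (X ^ 2 - 5 * X + 1) * (X ^ 2 - 3 * X + 1) := by
  have h : Mex.charmatrix =
      !![X - 3, 1, 2, -1;
         1, X - 3, -1, 2;
         1, 0, X - 1, 0;
         0, 1, 0, X - 1] := by
    ext1 i j
    fin_cases i <;> fin_cases j <;> simp [Mex]
  rw [Matrix.charpoly, h]
  simp [Matrix.det_succ_row_zero, Fin.sum_univ_succ, Fin.succAbove]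
  ring

theorem Mex_map_charpoly :
    (Mex.map (Int.cast : ℤ → ℝ)).charpoly =
      (X ^ 2 - 5 * X + 1) * (X ^ 2 - 3 * X + 1) := by
  have h := Matrix.charpoly_map Mex (Int.castRingHom ℝ)
  rw [Mex_charpoly_eq_mul] at h
  simpa using h

/-- A monic quadratic over `ℝ` with discriminant `d ≥ 0` splits by the quadratic formula. -/
theorem quadratic_eq_mul_X_sub_C {b c d : ℝ} (hd : 0 ≤ d) (h : b ^ 2 - 4 * c = d) :
    (X ^ 2 - C b * X + C c : ℝ[X]) =
      (X - C ((b + Real.sqrt d) / 2)) * (X - C ((b - Real.sqrt d) / 2)) := by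
  have hs := Real.sq_sqrt hd
  have hb : b = (b + Real.sqrt d) / 2 + (b - Real.sqrt d) / 2 := by ring
  have hc : c = (b + Real.sqrt d) / 2 * ((b - Real.sqrt d) / 2) := by linarith
  have hb' := congrArg (C : ℝ → ℝ[X]) hb
  have hc' := congrArg (C : ℝ → ℝ[X]) hc
  rw [C_add] at hb'
  rw [C_mul] at hc'
  linear_combination -X * hb' + hc'

theorem Mex_map_charpoly_roots :
    (Mex.map (Int.cast : ℤ → ℝ)).charpoly.roots =
      ({(5 + Real.sqrt 21) / 2, (5 - Real.sqrt 21) / 2,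
        (3 + Real.sqrt 5) / 2, (3 - Real.sqrt 5) / 2} : Multiset ℝ) := by
  have h₁ := quadratic_eq_mul_X_sub_C (b := 5) (c := 1) (d := 21) (by norm_num) (by norm_num)
  have h₂ := quadratic_eq_mul_X_sub_C (b := 3) (c := 1) (d := 5) (by norm_num) (by norm_num)
  rw [C_1, C_ofNat] at h₁ h₂
  rw [Mex_map_charpoly, h₁, h₂, ← roots_multiset_prod_X_sub_C
    ({(5 + Real.sqrt 21) / 2, (5 - Real.sqrt 21) / 2,
      (3 + Real.sqrt 5) / 2, (3 - Real.sqrt 5) / 2} : Multiset ℝ)]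
  simp [mul_assoc]

/-- The characteristic polynomial of `Mex` is `(X² − 5X + 1)(X² − 3X + 1)
= X⁴ − 8X³ + 17X² − 8X + 1`; over `ℝ` its eigenvalues are `(5±√21)/2` and `(3±√5)/2`,
each of algebraic multiplicity one, and `1` is not an eigenvalue. -/
theorem Mex_charpoly :
    Mex.charpoly = (X ^ 2 - 5 * X + 1) * (X ^ 2 - 3 * X + 1) ∧
    Mex.charpoly = X ^ 4 - 8 * X ^ 3 + 17 * X ^ 2 - 8 * X + 1 ∧
    (Mex.map (Int.cast : ℤ → ℝ)).charpoly.roots =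
      ({(5 + Real.sqrt 21) / 2, (5 - Real.sqrt 21) / 2,
        (3 + Real.sqrt 5) / 2, (3 - Real.sqrt 5) / 2} : Multiset ℝ) ∧
    (Mex.map (Int.cast : ℤ → ℝ)).charpoly.roots.Nodup ∧
    ¬ Module.End.HasEigenvalue
        (Matrix.mulVecLin (Mex.map (Int.cast : ℤ → ℝ))) 1 := by
  refine ⟨Mex_charpoly_eq_mul, ?_, Mex_map_charpoly_roots, ?_, ?_⟩
  · rw [Mex_charpoly_eq_mul]
    ring
  · have h₁ : 4 < Real.sqrt 21 := Real.lt_sqrt_of_sq_lt (by norm_num)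
    have h₂ : 2 < Real.sqrt 5 := Real.lt_sqrt_of_sq_lt (by norm_num)
    have h₃ : 2 + Real.sqrt 5 < Real.sqrt 21 := by
      apply Real.lt_sqrt_of_sq_lt
      nlinarith [Real.sq_sqrt (show (0 : ℝ) ≤ 5 by norm_num)]
    rw [Mex_map_charpoly_roots]
    simp only [Multiset.insert_eq_cons, Multiset.nodup_cons, Multiset.mem_cons,
      Multiset.mem_singleton, Multiset.nodup_singleton, not_or]
    refine ⟨⟨?_, ?_, ?_⟩, ⟨?_, ?_⟩, ?_, trivial⟩ <;> intro h <;> linarith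
  · rw [← Matrix.toLin'_apply', Module.End.hasEigenvalue_iff_isRoot_charpoly,
      Matrix.charpoly_toLin', Mex_map_charpoly]
    norm_num [IsRoot]
end
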